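/- One-step supermartingale property of the posterior probability of the wrong model (second part of Proposition 1, for two candidate models): Let K = 2, let u_k, v_k be real numbers for k = 1,2, and let q = (q_1, q_2) be a probability vector. Then the expected posterior probability of model 2 when the outcome is drawn from model 1 is at most its prior probability: Σ_{y ∈ {−1,1}²} σ̃_1(y) · q'_2(y) ≤ q_2. -/

import Mathlib

/-- The logistic function `σ(h) = 1/(1 + exp(-h))`. -/
noncomputable def sig (h : ℝ) : ℝ := 1 / (1 + Real.exp (-h))

/-- Encoding of an element of `{-1, 1}` by a Boolean: `true ↦ 1`, `false ↦ -1`. -/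
def pm (b : Bool) : ℝ := if b then 1 else -1

/-- The likelihood `σ̃(y) = σ(y^c · u) · σ(y^s · v)` of the pair outcome
`y = (y^c, y^s) ∈ {-1,1}²` under the model with parameters `(u, v)`. -/
noncomputable def lik (u v : ℝ) (y : Bool × Bool) : ℝ :=
  sig (pm y.1 * u) * sig (pm y.2 * v)

theorem sig_pos (h : ℝ) : 0 < sig h := by
  unfold sig
  positivity

theorem sig_add_sig_neg (h : ℝ) : sig h + sig (-h) = 1 := by
  have hexp : Real.exp h * Real.exp (-h) = 1 := by
    rw [← Real.exp_add, add_neg_cancel, Real.exp_zero]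
  have h₁ : 1 + Real.exp (-h) ≠ 0 := by positivity
  have h₂ : 1 + Real.exp h ≠ 0 := by positivity
  unfold sig
  rw [neg_neg, div_add_div _ _ h₁ h₂, div_eq_one_iff_eq (mul_ne_zero h₁ h₂)]
  linarith

theorem lik_pos (u v : ℝ) (y : Bool × Bool) : 0 < lik u v y :=
  mul_pos (sig_pos _) (sig_pos _)

theorem sum_lik (u v : ℝ) : ∑ y : Bool × Bool, lik u v y = 1 := by
  simp only [Fintype.sum_prod_type, Fintype.sum_bool, lik, pm, if_true, Bool.false_eq_true,
    if_false, one_mul, neg_one_mul]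
  rw [← mul_add, ← mul_add, ← add_mul, sig_add_sig_neg, sig_add_sig_neg, one_mul]

/-- The harmonic-type mean of two positive numbers with weights `p, r` is at most the arithmetic
mean with the weights exchanged. -/
theorem mul_div_weighted_le {a b p r : ℝ} (ha : 0 < a) (hb : 0 < b) (hp : 0 ≤ p) (hr : 0 ≤ r)
    (hpr : p + r = 1) : a * b / (p * a + r * b) ≤ r * a + p * b := by
  obtain rfl : p = 1 - r := by linarith
  have hpos : 0 < (1 - r) * a + r * b := by
    rcases hr.eq_or_lt with rfl | hr
    · simpa using ha
    · have := mul_nonneg hp ha.le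
      positivity
  rw [div_le_iff₀ hpos]
  nlinarith [mul_nonneg (mul_nonneg hp hr) (sq_nonneg (a - b))]

/-- One-step supermartingale property of the posterior probability of the wrong model
(two candidate models): the expected posterior probability of model `2` (index `1`), when
the outcome is drawn from model `1` (index `0`), is at most its prior probability. -/
theorem expected_posterior_wrong_model_le_prior
    (u v : Fin 2 → ℝ) (q : Fin 2 → ℝ)
    (hq : ∀ k, 0 ≤ q k) (hsum : ∑ k, q k = 1) :
    ∑ y : Bool × Bool, lik (u 0) (v 0) y *
      (q 1 * lik (u 1) (v 1) y / ∑ j, q j * lik (u j) (v j) y) ≤ q 1 := by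
  have hq01 : q 0 + q 1 = 1 := by simpa [Fin.sum_univ_two] using hsum
  calc
    _ ≤ ∑ y : Bool × Bool, q 1 * (q 1 * lik (u 0) (v 0) y + q 0 * lik (u 1) (v 1) y) := by
      refine Finset.sum_le_sum fun y _ => ?_
      rw [Fin.sum_univ_two, mul_div_assoc, mul_left_comm, ← mul_div_assoc]
      exact mul_le_mul_of_nonneg_left
        (mul_div_weighted_le (lik_pos _ _ y) (lik_pos _ _ y) (hq 0) (hq 1) hq01) (hq 1)
    _ = q 1 := by
      rw [← Finset.mul_sum, Finset.sum_add_distrib, ← Finset.mul_sum, ← Finset.mul_sum,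
        sum_lik, sum_lik, mul_one, mul_one, add_comm, hq01, mul_one]
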